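/- arXiv:2003.10231 — 2 statements merged into one kernel-verified Lean document; each statement's English description precedes it below -/
import Mathlib

section
/- Let 0 < k < n, let I be a k-element subset of [n] with complement J, and let X ⊆ I × J be such that the bipartite graph G(X) on [n] (with edges between i ∈ I and j ∈ J exactly when (i,j) ∈ X) is a tree on all n vertices. Let ℬ(X) be the family of k-element subsets B of [n] such that there exists a bijection f : I ∖ B → J ∩ B with (i, f(i)) ∈ X for all i ∈ I ∖ B (a matching of I ∖ B onto J ∩ B in G(X); this is the basis family of the principal transversal matroid of G(X)). Then ℬ(X) is the basis family of a positroid on [n] if and only if X is noncrossing, i.e., there do not exist (i₁,j₁), (i₂,j₂) ∈ X and elements a < b < c < d of [n] with {a,c} = {i₁,j₁} and {b,d} = {i₂,j₂}, or {a,c} = {i₂,j₂} and {b,d} = {i₁,j₁}. -/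
/-- The maximal minor `p_I(A)` of a `k × n` matrix `A` on the columns indexed by the
`k`-element subset `I`, taken in increasing order (junk value `0` if `I.card ≠ k`). -/
noncomputable def pMinor {R : Type*} [CommRing R] {k n : ℕ}
    (A : Matrix (Fin k) (Fin n) R) (I : Finset (Fin n)) : R :=
  if hI : I.card = k then
    Matrix.det (Matrix.of fun r c => A r ((I.orderIsoOfFin hI c : Fin n)))
  else 0

/-- `ℬ` is the basis family of a positroid on `[n]`: the family of `k`-subsets with
nonzero maximal minor, for some real `k × n` matrix with all maximal minors `≥ 0`. -/
def IsPositroidFamily (n k : ℕ) (ℬ : Set (Finset (Fin n))) : Prop :=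
  ∃ A : Matrix (Fin k) (Fin n) ℝ,
    (∀ I : Finset (Fin n), I.card = k → 0 ≤ pMinor A I) ∧
    (∀ I : Finset (Fin n), I ∈ ℬ ↔ I.card = k ∧ pMinor A I ≠ 0)

/-- The basis family of the principal transversal matroid of the bipartite graph
`G(X)`: the `k`-subsets `B` such that `I \ B` can be matched onto `B \ I` in `G(X)`. -/
def transversalBases (n k : ℕ) (I : Finset (Fin n)) (X : Set (Fin n × Fin n)) :
    Set (Finset (Fin n)) :=
  {B | B.card = k ∧ ∃ f : Fin n → Fin n,
    Set.BijOn f ↑(I \ B) ↑(B \ I) ∧ ∀ i ∈ I \ B, (i, f i) ∈ X}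

/-- `X ⊆ I × J` is noncrossing: no two of its edges cross when `1, …, n` are placed on
the boundary of a disk in the standard circular order. -/
def Noncrossing {n : ℕ} (X : Set (Fin n × Fin n)) : Prop :=
  ¬ ∃ p ∈ X, ∃ q ∈ X, ∃ a b c d : Fin n, a < b ∧ b < c ∧ c < d ∧
    ((({p.1, p.2} : Finset (Fin n)) = {a, c} ∧ ({q.1, q.2} : Finset (Fin n)) = {b, d}) ∨
     (({p.1, p.2} : Finset (Fin n)) = {b, d} ∧ ({q.1, q.2} : Finset (Fin n)) = {a, c}))

open Finset

/-- The sign contributed by `c` to an arc from `a` to `b`: `-1` if `c` lies strictly between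
`a` and `b`, and `1` otherwise. -/
def separationSign {n : ℕ} (a b c : Fin n) : ℝ :=
  if (a < c ∧ c < b) ∨ (b < c ∧ c < a) then -1 else 1

/-- The arcs `{a, c}` and `{b, d}` cross: exactly one of `b, d` is strictly between
`a` and `c`. -/
def ArcsCross {n : ℕ} (a c b d : Fin n) : Prop :=
  ¬ (((a < b ∧ b < c) ∨ (c < b ∧ b < a)) ↔ ((a < d ∧ d < c) ∨ (c < d ∧ d < a)))

/-- The sign contributed by the arcs `a ⟶ c` and `b ⟶ d`, where `a < b`, to a term of the
expansion of a maximal minor. -/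
def arcPairSign {n : ℕ} (a b c d : Fin n) : ℝ :=
  (if c < d then 1 else -1) * (separationSign b d a * separationSign a c b)

lemma separationSign_mul_self {n : ℕ} (a b c : Fin n) :
    separationSign a b c * separationSign a b c = 1 := by
  unfold separationSign; split_ifs <;> norm_num

lemma separationSign_left {n : ℕ} (a b : Fin n) : separationSign a b a = 1 := by
  simp [separationSign]

lemma separationSign_self {n : ℕ} (a b : Fin n) : separationSign a a b = 1 := by
  unfold separationSign; rw [if_neg]; omega

lemma arcPairSign_of_not_arcsCross {n : ℕ} {a b c d : Fin n} (hab : a < b) (hcd : c ≠ d)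
    (had : a ≠ d) (hbc : b ≠ c) (h : ¬ ArcsCross a c b d) : arcPairSign a b c d = 1 := by
  unfold ArcsCross at h
  unfold arcPairSign separationSign
  split_ifs <;> first | (exfalso; omega) | norm_num

lemma arcPairSign_of_arcsCross {n : ℕ} {a b c d : Fin n} (hab : a < b) (hcd : c ≠ d)
    (had : a ≠ d) (hbc : b ≠ c) (h : ArcsCross a c b d) : arcPairSign a b c d = -1 := by
  unfold ArcsCross at h
  unfold arcPairSign separationSign
  split_ifs <;> first | (exfalso; omega) | norm_num

lemma not_arcsCross_self_left {n : ℕ} (a b d : Fin n) : ¬ ArcsCross a a b d := by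
  unfold ArcsCross; omega

lemma not_arcsCross_self_right {n : ℕ} (a c b : Fin n) : ¬ ArcsCross a c b b := by
  unfold ArcsCross; omega

lemma ArcsCross.symm {n : ℕ} {a b c d : Fin n} (h : ArcsCross a c b d) (hab : a ≠ b)
    (hcd : c ≠ d) (had : a ≠ d) (hbc : b ≠ c) : ArcsCross b d a c := by
  unfold ArcsCross at *; omega

lemma Noncrossing.not_arcsCross {n : ℕ} {X : Set (Fin n × Fin n)} (hX : Noncrossing X)
    {a b c d : Fin n} (hac : (a, c) ∈ X) (hbd : (b, d) ∈ X) (hab : a ≠ b) (hcd : c ≠ d)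
    (had : a ≠ d) (hbc : b ≠ c) : ¬ ArcsCross a c b d := by
  intro h
  apply hX
  refine ⟨(a, c), hac, (b, d), hbd, ?_⟩
  have key : ∀ u v : Fin n, ∃ l m : Fin n, l ≤ m ∧ ((u = l ∧ v = m) ∨ (u = m ∧ v = l)) ∧
      ({u, v} : Finset (Fin n)) = {l, m} := by
    intro u v
    rcases le_total u v with h | h
    · exact ⟨u, v, h, by simp, rfl⟩
    · exact ⟨v, u, h, by simp, pair_comm _ _⟩
  obtain ⟨l, m, hlm, hac', e⟩ := key a c
  obtain ⟨l', m', hlm', hbd', e'⟩ := key b d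
  unfold ArcsCross at h
  by_cases hl : l < l'
  · exact ⟨l, l', m, m', hl, by omega, by omega, .inl ⟨e, e'⟩⟩
  · exact ⟨l', l, m', m, by omega, by omega, by omega, .inr ⟨e, e'⟩⟩

lemma exists_arcsCross_of_not_noncrossing {n : ℕ} {X : Set (Fin n × Fin n)}
    (hX : ¬ Noncrossing X) : ∃ a c b d : Fin n, (a, c) ∈ X ∧ (b, d) ∈ X ∧ a ≠ b ∧ c ≠ d ∧
      a ≠ d ∧ b ≠ c ∧ ArcsCross a c b d := by
  unfold Noncrossing at hX
  push Not at hX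
  obtain ⟨⟨p₁, p₂⟩, hp, ⟨q₁, q₂⟩, hq, a, b, c, d, hab, hbc, hcd, h⟩ := hX
  refine ⟨p₁, p₂, q₁, q₂, hp, hq, ?_⟩
  have pair : ∀ u v w z : Fin n, ({u, v} : Finset (Fin n)) = {w, z} →
      (u = w ∧ v = z) ∨ (u = z ∧ v = w) := by
    intro u v w z h
    rw [← Set.pair_eq_pair_iff]
    simpa using congrArg (fun s : Finset (Fin n) => (s : Set (Fin n))) h
  unfold ArcsCross
  rcases h with ⟨h₁, h₂⟩ | ⟨h₁, h₂⟩ <;>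
    have := pair _ _ _ _ h₁ <;> have := pair _ _ _ _ h₂ <;> dsimp only at * <;> omega

/-- The sign of the system of arcs `x r ⟶ g r`. -/
noncomputable def arcSign {n k : ℕ} (x g : Fin k → Fin n) : ℝ :=
  ∏ s, ∏ r ∈ Ioi s, arcPairSign (x s) (x r) (g s) (g r)

/-- The matrix whose `(r, c)` entry is `T r c`, with the sign `(-1)^m`, where `m` is the number
of values of `x` strictly between `x r` and `c`. -/
noncomputable def signedMatrix {n k : ℕ} (x : Fin k → Fin n) (T : Fin k → Fin n → ℝ) :
    Matrix (Fin k) (Fin n) ℝ :=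
  Matrix.of fun r c => (∏ s, separationSign (x r) c (x s)) * T r c

lemma prod_separationSign {n k : ℕ} (x g : Fin k → Fin n) :
    ∏ r, ∏ s, separationSign (x r) (g r) (x s) =
      ∏ s, ∏ r ∈ Ioi s, separationSign (x r) (g r) (x s) * separationSign (x s) (g s) (x r) := by
  rw [prod_prod_Ioi_mul_eq_prod_prod_off_diag (fun r s => separationSign (x r) (g r) (x s)),
    prod_comm]
  refine prod_congr rfl fun s _ => ?_
  rw [Fintype.prod_eq_mul_prod_compl s, separationSign_left, one_mul]

lemma pMinor_signedMatrix {n k : ℕ} (x : Fin k → Fin n) (T : Fin k → Fin n → ℝ)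
    {B : Finset (Fin n)} (hB : B.card = k) :
    pMinor (signedMatrix x T) B = ∑ σ : Equiv.Perm (Fin k),
      arcSign x (fun r => B.orderEmbOfFin hB (σ r)) * ∏ r, T r (B.orderEmbOfFin hB (σ r)) := by
  rw [pMinor, dif_pos hB, ← Matrix.det_transpose, Matrix.det_apply']
  refine sum_congr rfl fun σ _ => ?_
  simp only [Matrix.transpose_apply, Matrix.of_apply, signedMatrix, prod_mul_distrib,
    coe_orderIsoOfFin_apply]
  rw [← mul_assoc, prod_separationSign x, Equiv.Perm.sign_eq_prod_prod_Ioi]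
  congr 1
  push_cast
  simp only [arcSign, arcPairSign, OrderEmbedding.lt_iff_lt, prod_mul_distrib]
  congr 1
  refine prod_congr rfl fun s _ => prod_congr rfl fun r _ => ?_
  split_ifs <;> simp

lemma exists_perm_orderEmbOfFin_eq {n k : ℕ} {B : Finset (Fin n)} (hB : B.card = k)
    {g : Fin k → Fin n} (hg : g.Injective) (hgB : ∀ r, g r ∈ B) :
    ∃ σ : Equiv.Perm (Fin k), ∀ r, B.orderEmbOfFin hB (σ r) = g r := by
  let τ : Fin k → Fin k := fun r => (B.orderIsoOfFin hB).symm ⟨g r, hgB r⟩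
  have hτ : τ.Injective := fun r s h => by
    simpa [τ] using hg (by simpa [τ] using h)
  refine ⟨Equiv.ofBijective τ (Finite.injective_iff_bijective.1 hτ), fun r => ?_⟩
  rw [← coe_orderIsoOfFin_apply]
  simp [τ]

lemma pMinor_signedMatrix_eq_of_unique {n k : ℕ} (x : Fin k → Fin n) (T : Fin k → Fin n → ℝ)
    {B : Finset (Fin n)} (hB : B.card = k) {g₀ : Fin k → Fin n} (hg₀ : g₀.Injective)
    (hg₀B : ∀ r, g₀ r ∈ B)
    (huniq : ∀ g : Fin k → Fin n, g.Injective → (∀ r, g r ∈ B) → ∏ r, T r (g r) ≠ 0 → g = g₀) :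
    pMinor (signedMatrix x T) B = arcSign x g₀ * ∏ r, T r (g₀ r) := by
  obtain ⟨σ₀, hσ₀⟩ := exists_perm_orderEmbOfFin_eq hB hg₀ hg₀B
  rw [pMinor_signedMatrix x T hB, Fintype.sum_eq_single σ₀]
  · simp only [hσ₀]
  · intro σ hσ
    by_contra h
    apply hσ
    have := huniq _ ((B.orderEmbOfFin hB).injective.comp σ.injective)
      (fun r => orderEmbOfFin_mem B hB _) (right_ne_zero_of_mul h)
    ext1 r
    apply (B.orderEmbOfFin hB).injective
    rw [hσ₀, ← this, Function.comp_apply]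

/-- On the columns indexed by the values of `x`, the matrix `T` is the identity. -/
def IsUnitOn {n k : ℕ} (x : Fin k → Fin n) (T : Fin k → Fin n → ℝ) : Prop :=
  ∀ r s, T r (x s) = if r = s then 1 else 0

section

variable {n k : ℕ} {x g : Fin k → Fin n} {T : Fin k → Fin n → ℝ}

lemma IsUnitOn.eq_of_prod_ne_zero (hT : IsUnitOn x T) (h : ∏ r, T r (g r) ≠ 0) {r s : Fin k}
    (hrs : g r = x s) : r = s := by
  have h' := prod_ne_zero_iff.1 h r (mem_univ r)
  rw [hrs, hT] at h'
  by_contra hne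
  exact h' (if_neg hne)

lemma arcPairSign_eq_one_of_fixed (hx : StrictMono x) (hg : g.Injective)
    (hgx : ∀ r s, g r = x s → r = s) {r s : Fin k} (hrs : r < s)
    (hfix : g r = x r ∨ g s = x s) : arcPairSign (x r) (x s) (g r) (g s) = 1 := by
  apply arcPairSign_of_not_arcsCross (hx hrs) (hg.ne hrs.ne)
    (fun h => hrs.ne' (hgx _ _ h.symm)) (fun h => hrs.ne (hgx _ _ h.symm))
  rcases hfix with h | h
  · rw [h]; exact not_arcsCross_self_left _ _ _
  · rw [h]; exact not_arcsCross_self_right _ _ _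

lemma arcSign_eq_one_of_fixed (hx : StrictMono x) (hg : g.Injective)
    (hgx : ∀ r s, g r = x s → r = s) (r₀ : Fin k) (hfix : ∀ r, r ≠ r₀ → g r = x r) :
    arcSign x g = 1 := by
  refine prod_eq_one fun s _ => prod_eq_one fun r hr => ?_
  rw [mem_Ioi] at hr
  apply arcPairSign_eq_one_of_fixed hx hg hgx hr
  by_cases h : s = r₀
  · exact .inr (hfix r (h ▸ hr.ne'))
  · exact .inl (hfix s h)

lemma arcSign_eq_neg_one_of_fixed (hx : StrictMono x) (hg : g.Injective)
    (hgx : ∀ r s, g r = x s → r = s) {r₁ r₂ : Fin k} (hr : r₁ < r₂)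
    (hcross : ArcsCross (x r₁) (g r₁) (x r₂) (g r₂))
    (hfix : ∀ r, r ≠ r₁ → r ≠ r₂ → g r = x r) : arcSign x g = -1 := by
  unfold arcSign
  rw [Fintype.prod_eq_single r₁, prod_eq_single r₂]
  · exact arcPairSign_of_arcsCross (hx hr) (hg.ne hr.ne)
      (fun h => hr.ne' (hgx _ _ h.symm)) (fun h => hr.ne (hgx _ _ h.symm)) hcross
  · intro r hr' hne
    rw [mem_Ioi] at hr'
    exact arcPairSign_eq_one_of_fixed hx hg hgx hr' (.inr (hfix r hr'.ne' hne))
  · simp [hr]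
  · intro s hs
    refine prod_eq_one fun r hr' => ?_
    rw [mem_Ioi] at hr'
    apply arcPairSign_eq_one_of_fixed hx hg hgx hr'
    by_cases h : s = r₂
    · exact .inr (hfix r (by omega) (by omega))
    · exact .inl (hfix s hs h)

/-- The minor obtained by exchanging one element is the corresponding entry. -/
lemma pMinor_exchange (hx : StrictMono x) (hT : IsUnitOn x T) (r₀ : Fin k) {j : Fin n}
    (hj : j ∉ Set.range x) {B : Finset (Fin n)} (hB : B.card = k)
    (hBmem : ∀ c, c ∈ B ↔ c = j ∨ ∃ r, r ≠ r₀ ∧ c = x r) :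
    pMinor (signedMatrix x T) B = T r₀ j := by
  have hjx : ∀ r, x r ≠ j := fun r h => hj ⟨r, h⟩
  have hg₀ : (Function.update x r₀ j).Injective := by
    intro r s h
    by_cases hr : r = r₀ <;> by_cases hs : s = r₀ <;>
      simp_all [Function.update_apply, hx.injective.eq_iff, eq_comm]
  have hg₀x : ∀ r s, Function.update x r₀ j r = x s → r = s := by
    intro r s h
    by_cases hr : r = r₀
    · subst hr; simp only [Function.update_self] at h; exact absurd h.symm (hjx s)
    · rw [Function.update_of_ne hr] at h; exact hx.injective h
  have hfix : ∀ r, r ≠ r₀ → Function.update x r₀ j r = x r := fun r hr =>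
    Function.update_of_ne hr _ _
  rw [pMinor_signedMatrix_eq_of_unique x T hB hg₀, arcSign_eq_one_of_fixed hx hg₀ hg₀x r₀ hfix,
    Fintype.prod_eq_single r₀, one_mul, Function.update_self]
  · intro r hr; rw [hfix r hr, hT, if_pos rfl]
  · intro r
    rw [hBmem]
    by_cases hr : r = r₀
    · subst hr; simp
    · exact .inr ⟨r, hr, hfix r hr⟩
  · intro g hg hgB hne
    have h₀ : g r₀ = j := by
      rcases (hBmem _).1 (hgB r₀) with h | ⟨r, hr, h⟩
      · exact h
      · exact absurd (hT.eq_of_prod_ne_zero hne h).symm hr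
    funext r
    by_cases hr : r = r₀
    · subst hr; simpa using h₀
    · rw [hfix r hr]
      rcases (hBmem _).1 (hgB r) with h | ⟨s, hs, h⟩
      · exact absurd (hg (h.trans h₀.symm)) hr
      · rw [h, hT.eq_of_prod_ne_zero hne h]

/-- The minor obtained by exchanging two elements along crossing arcs is nonpositive if the
opposite exchange is impossible. -/
lemma pMinor_double_exchange_nonpos (hx : StrictMono x) (hT : IsUnitOn x T)
    (hT₀ : ∀ r c, 0 ≤ T r c) {r₁ r₂ : Fin k} (hr : r₁ < r₂) {j₁ j₂ : Fin n}
    (hcross : ArcsCross (x r₁) j₁ (x r₂) j₂) (hzero : T r₁ j₂ * T r₂ j₁ = 0)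
    {B : Finset (Fin n)} (hB : B.card = k)
    (hBmem : ∀ c ∈ B, c = j₁ ∨ c = j₂ ∨ ∃ r, r ≠ r₁ ∧ r ≠ r₂ ∧ c = x r) :
    pMinor (signedMatrix x T) B ≤ 0 := by
  rw [pMinor_signedMatrix x T hB]
  refine sum_nonpos fun σ _ => ?_
  set g : Fin k → Fin n := fun r => B.orderEmbOfFin hB (σ r) with hgdef
  have hg : g.Injective := (B.orderEmbOfFin hB).injective.comp σ.injective
  have hgB : ∀ r, g r ∈ B := fun r => orderEmbOfFin_mem B hB _
  change arcSign x g * ∏ r, T r (g r) ≤ 0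
  by_cases hne : ∏ r, T r (g r) = 0
  · simp [hne]
  have hTg : ∀ r, T r (g r) ≠ 0 := fun r => prod_ne_zero_iff.1 hne r (mem_univ r)
  have hgx : ∀ r s, g r = x s → r = s := fun r s => hT.eq_of_prod_ne_zero hne
  have h₁ : g r₁ = j₁ ∨ g r₁ = j₂ := by
    rcases hBmem _ (hgB r₁) with h | h | ⟨r, hr, -, h⟩
    · exact .inl h
    · exact .inr h
    · exact absurd (hgx _ _ h).symm hr
  have h₂ : g r₂ = j₁ ∨ g r₂ = j₂ := by
    rcases hBmem _ (hgB r₂) with h | h | ⟨r, -, hr, h⟩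
    · exact .inl h
    · exact .inr h
    · exact absurd (hgx _ _ h).symm hr
  have h₁₂ : g r₁ ≠ g r₂ := hg.ne hr.ne
  have hstraight : g r₁ = j₁ ∧ g r₂ = j₂ := by
    rcases h₁ with h₁ | h₁ <;> rcases h₂ with h₂ | h₂
    · exact absurd (h₁.trans h₂.symm) h₁₂
    · exact ⟨h₁, h₂⟩
    · rw [← h₁, ← h₂] at hzero
      exact absurd hzero (mul_ne_zero (hTg _) (hTg _))
    · exact absurd (h₁.trans h₂.symm) h₁₂
  have hfix : ∀ r, r ≠ r₁ → r ≠ r₂ → g r = x r := by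
    intro r hr₁ hr₂
    rcases hBmem _ (hgB r) with h | h | ⟨s, -, -, h⟩
    · exact absurd (hg (h.trans hstraight.1.symm)) hr₁
    · exact absurd (hg (h.trans hstraight.2.symm)) hr₂
    · rw [h, hgx _ _ h]
  rw [arcSign_eq_neg_one_of_fixed hx hg hgx hr (by rwa [hstraight.1, hstraight.2]) hfix]
  have := prod_nonneg fun r (_ : r ∈ (univ : Finset (Fin k))) => hT₀ r (g r)
  linarith

end

/-- Every matrix that is the identity on the columns `x` is a signed matrix. -/
lemma exists_signedMatrix_eq {n k : ℕ} {x : Fin k → Fin n} (A : Matrix (Fin k) (Fin n) ℝ)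
    (hA : ∀ r s, A r (x s) = if r = s then 1 else 0) :
    ∃ T, IsUnitOn x T ∧ signedMatrix x T = A := by
  refine ⟨fun r c => (∏ s, separationSign (x r) c (x s)) * A r c, fun r s => ?_, ?_⟩
  · change _ * A r (x s) = _
    rw [hA]
    split_ifs with h
    · subst h; simp [separationSign_self]
    · simp
  · ext r c
    simp only [signedMatrix, Matrix.of_apply]
    rw [← mul_assoc, ← prod_mul_distrib, prod_eq_one, one_mul]
    exact fun s _ => separationSign_mul_self _ _ _

lemma pMinor_mul {n k : ℕ} (P : Matrix (Fin k) (Fin k) ℝ) (A : Matrix (Fin k) (Fin n) ℝ)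
    (B : Finset (Fin n)) : pMinor (P * A) B = P.det * pMinor A B := by
  unfold pMinor
  split_ifs with h
  · rw [← Matrix.det_mul]; rfl
  · simp

/-- A positroid with basis `I` is represented by a matrix that is the identity on the
columns `I`. -/
lemma IsPositroidFamily.exists_signedMatrix {n k : ℕ} {ℬ : Set (Finset (Fin n))}
    (h : IsPositroidFamily n k ℬ) {I : Finset (Fin n)} (hI : I.card = k) (hIB : I ∈ ℬ) :
    ∃ T, IsUnitOn (I.orderEmbOfFin hI) T ∧
      (∀ B, B.card = k → 0 ≤ pMinor (signedMatrix (I.orderEmbOfFin hI) T) B) ∧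
      ∀ B, B ∈ ℬ ↔ B.card = k ∧ pMinor (signedMatrix (I.orderEmbOfFin hI) T) B ≠ 0 := by
  obtain ⟨A, hA, hAB⟩ := h
  set M : Matrix (Fin k) (Fin k) ℝ := A.submatrix id (I.orderEmbOfFin hI) with hM
  have hdet : M.det = pMinor A I := by rw [pMinor, dif_pos hI]; rfl
  have hpos : 0 < M.det := by
    rw [hdet]; exact lt_of_le_of_ne (hA I hI) ((hAB I).1 hIB).2.symm
  have hinv : 0 < (M⁻¹).det := by
    rw [Matrix.det_nonsing_inv, Ring.inverse_eq_inv']; exact inv_pos.2 hpos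
  obtain ⟨T, hT, hTA⟩ := exists_signedMatrix_eq (x := I.orderEmbOfFin hI) (M⁻¹ * A) (by
    intro r s
    have : (M⁻¹ * M) r s = if r = s then 1 else 0 := by
      rw [Matrix.nonsing_inv_mul _ hpos.ne'.isUnit, Matrix.one_apply]
    exact this)
  refine ⟨T, hT, fun B hB => ?_, fun B => ?_⟩
  · rw [hTA, pMinor_mul]; exact mul_nonneg hinv.le (hA B hB)
  · rw [hTA, pMinor_mul, hAB, mul_ne_zero_iff, and_iff_right hinv.ne']

lemma self_mem_transversalBases {n k : ℕ} {I : Finset (Fin n)} (hI : I.card = k)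
    (X : Set (Fin n × Fin n)) : I ∈ transversalBases n k I X :=
  ⟨hI, id, by simp⟩

lemma exchange_mem_transversalBases_iff {n k : ℕ} {I : Finset (Fin n)} {i j : Fin n}
    (hi : i ∈ I) (hj : j ∉ I) (X : Set (Fin n × Fin n))
    (hcard : (insert j (I.erase i)).card = k) :
    insert j (I.erase i) ∈ transversalBases n k I X ↔ (i, j) ∈ X := by
  have hij : i ≠ j := fun h => hj (h ▸ hi)
  have h₁ : I \ insert j (I.erase i) = {i} := by
    ext c; simp only [mem_sdiff, mem_insert, mem_erase, mem_singleton]; grind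
  have h₂ : insert j (I.erase i) \ I = {j} := by
    ext c; simp only [mem_sdiff, mem_insert, mem_erase, mem_singleton]; grind
  simp only [transversalBases, Set.mem_ofPred_eq, h₁, h₂, hcard, true_and, coe_singleton,
    Set.bijOn_singleton, mem_singleton, forall_eq]
  exact ⟨fun ⟨f, hf, h⟩ => hf ▸ h, fun h => ⟨fun _ => j, rfl, h⟩⟩

lemma double_exchange_mem_transversalBases {n k : ℕ} {I : Finset (Fin n)} {i₁ i₂ j₁ j₂ : Fin n}
    {X : Set (Fin n × Fin n)} (hi₁ : i₁ ∈ I) (hi₂ : i₂ ∈ I) (hj₁ : j₁ ∉ I) (hj₂ : j₂ ∉ I)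
    (hi : i₁ ≠ i₂) (hj : j₁ ≠ j₂) (h₁ : (i₁, j₁) ∈ X) (h₂ : (i₂, j₂) ∈ X)
    (hcard : (insert j₁ (insert j₂ ((I.erase i₁).erase i₂))).card = k) :
    insert j₁ (insert j₂ ((I.erase i₁).erase i₂)) ∈ transversalBases n k I X := by
  have e₁ : I \ insert j₁ (insert j₂ ((I.erase i₁).erase i₂)) = {i₁, i₂} := by
    ext c; simp only [mem_sdiff, mem_insert, mem_erase, mem_singleton]; grind
  have e₂ : insert j₁ (insert j₂ ((I.erase i₁).erase i₂)) \ I = {j₁, j₂} := by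
    ext c; simp only [mem_sdiff, mem_insert, mem_erase, mem_singleton]; grind
  refine ⟨hcard, fun i => if i = i₁ then j₁ else j₂, ?_, ?_⟩
  · rw [e₁, e₂]
    refine ⟨?_, ?_, ?_⟩
    · intro c hc; dsimp only; split_ifs <;> simp
    · intro c hc d hd h
      simp only [coe_insert, coe_singleton, Set.mem_insert_iff, Set.mem_singleton_iff] at hc hd
      dsimp only at h
      grind
    · intro c hc
      simp only [coe_insert, coe_singleton, Set.mem_insert_iff, Set.mem_singleton_iff] at hc
      rcases hc with rfl | rfl
      · exact ⟨i₁, by simp, by simp⟩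
      · exact ⟨i₂, by simp, by simp [hi.symm]⟩
  · rw [e₁]
    intro i h
    simp only [mem_insert, mem_singleton] at h
    rcases h with rfl | rfl
    · simpa using h₁
    · simpa [hi.symm] using h₂

lemma not_fourCycle_of_isAcyclic {V : Type*} {X : Set (V × V)}
    (h : (SimpleGraph.fromRel (fun a b => (a, b) ∈ X)).IsAcyclic) {i₁ i₂ j₁ j₂ : V}
    (hi : i₁ ≠ i₂) (hj : j₁ ≠ j₂) (h₁₁' : i₁ ≠ j₁) (h₁₂' : i₁ ≠ j₂) (h₂₁' : i₂ ≠ j₁)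
    (h₂₂' : i₂ ≠ j₂) (h₁₁ : (i₁, j₁) ∈ X) (h₂₂ : (i₂, j₂) ∈ X) (h₁₂ : (i₁, j₂) ∈ X) :
    (i₂, j₁) ∉ X := by
  intro h₂₁
  set G := SimpleGraph.fromRel (fun a b => (a, b) ∈ X)
  have adj : ∀ {a b : V}, a ≠ b → (a, b) ∈ X → G.Adj a b := fun hab hX => ⟨hab, .inl hX⟩
  let p : G.Walk i₁ i₂ := .cons (adj h₁₁' h₁₁) (.cons (adj h₂₁' h₂₁).symm .nil)
  let q : G.Walk i₁ i₂ := .cons (adj h₁₂' h₁₂) (.cons (adj h₂₂' h₂₂).symm .nil)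
  have hp : p.IsPath := by simp [p, SimpleGraph.Walk.isPath_def, hi, h₁₁', h₂₁'.symm]
  have hq : q.IsPath := by simp [q, SimpleGraph.Walk.isPath_def, hi, h₁₂', h₂₂'.symm]
  have hpq : p = q := congrArg Subtype.val
    ((h.subsingleton_path i₁ i₂).elim ⟨p, hp⟩ ⟨q, hq⟩)
  have := congrArg SimpleGraph.Walk.support hpq
  simp [p, q, hj] at this

lemma noncrossing_of_isPositroidFamily {n k : ℕ} {I : Finset (Fin n)} (hI : I.card = k)
    {X : Set (Fin n × Fin n)} (hX : ∀ p ∈ X, p.1 ∈ I ∧ p.2 ∉ I)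
    (hacyclic : (SimpleGraph.fromRel (fun a b => (a, b) ∈ X)).IsAcyclic)
    (h : IsPositroidFamily n k (transversalBases n k I X)) : Noncrossing X := by
  by_contra hcr
  obtain ⟨i₁, j₁, i₂, j₂, h₁, h₂, hi, hj, h₁₂, h₂₁, hcross⟩ :=
    exists_arcsCross_of_not_noncrossing hcr
  wlog hlt : i₁ < i₂ generalizing i₁ j₁ i₂ j₂
  · exact this i₂ j₂ i₁ j₁ h₂ h₁ hi.symm hj.symm h₂₁ h₁₂ (hcross.symm hi hj h₁₂ h₂₁) (by omega)
  obtain ⟨T, hT, hpos, hmem⟩ := h.exists_signedMatrix hI (self_mem_transversalBases hI X)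
  set x := I.orderEmbOfFin hI with hxdef
  have hx : StrictMono x := x.strictMono
  have hxI : ∀ r, x r ∈ I := orderEmbOfFin_mem I hI
  have hxmem : ∀ c, c ∈ I ↔ ∃ r, x r = c := fun c => by
    rw [← Set.mem_range, hxdef, range_orderEmbOfFin, mem_coe]
  have hxr : ∀ c, c ∉ I → c ∉ Set.range x := fun c hc h => hc ((hxmem c).2 h)
  have hcard : ∀ r j, j ∉ I → (insert j (I.erase (x r))).card = k := by
    intro r j hj
    rw [card_insert_of_notMem (fun h => hj (mem_of_mem_erase h)), card_erase_add_one (hxI r), hI]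
  have hminor : ∀ r j, j ∉ I → pMinor (signedMatrix x T) (insert j (I.erase (x r))) = T r j := by
    intro r j hj
    refine pMinor_exchange hx hT r (hxr j hj) (hcard r j hj) fun c => ?_
    rw [mem_insert, mem_erase, hxmem]
    refine or_congr_right ⟨?_, ?_⟩
    · rintro ⟨hc, s, rfl⟩
      exact ⟨s, fun h => hc (by rw [h]), rfl⟩
    · rintro ⟨s, hs, rfl⟩
      exact ⟨fun h => hs (hx.injective h), s, rfl⟩
  have hT₀ : ∀ r c, 0 ≤ T r c := by
    intro r c
    by_cases hc : c ∈ I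
    · obtain ⟨s, rfl⟩ := (hxmem c).1 hc
      rw [hT]; split_ifs <;> norm_num
    · rw [← hminor r c hc]; exact hpos _ (hcard r c hc)
  have hTX : ∀ r j, j ∉ I → T r j ≠ 0 → (x r, j) ∈ X := by
    intro r j hj hne
    rw [← hminor r j hj] at hne
    exact (exchange_mem_transversalBases_iff (hxI r) hj X (hcard r j hj)).1
      ((hmem _).2 ⟨hcard r j hj, hne⟩)
  obtain ⟨hi₁, hj₁⟩ := hX _ h₁
  obtain ⟨hi₂, hj₂⟩ := hX _ h₂
  obtain ⟨r₁, rfl⟩ := (hxmem i₁).1 hi₁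
  obtain ⟨r₂, rfl⟩ := (hxmem i₂).1 hi₂
  have hzero : T r₁ j₂ * T r₂ j₁ = 0 := by
    by_contra hne
    exact not_fourCycle_of_isAcyclic hacyclic hi hj (fun h => hj₁ (h ▸ hi₁)) h₁₂ h₂₁
      (fun h => hj₂ (h ▸ hi₂)) h₁ h₂ (hTX _ _ hj₂ (left_ne_zero_of_mul hne))
      (hTX _ _ hj₁ (right_ne_zero_of_mul hne))
  have hBcard : (insert j₁ (insert j₂ ((I.erase (x r₁)).erase (x r₂)))).card = k := by
    rw [card_insert_of_notMem (by simp [hj, hj₁]), card_insert_of_notMem (by simp [hj₂]),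
      card_erase_add_one (mem_erase.2 ⟨hi.symm, hi₂⟩), card_erase_add_one hi₁, hI]
  have hB := (hmem _).1
    (double_exchange_mem_transversalBases hi₁ hi₂ hj₁ hj₂ hi hj h₁ h₂ hBcard)
  refine hB.2 (le_antisymm ?_ (hpos _ hBcard))
  refine pMinor_double_exchange_nonpos hx hT hT₀ (hx.lt_iff_lt.1 hlt) hcross hzero hBcard ?_
  intro c hc
  rw [mem_insert, mem_insert, mem_erase, mem_erase, hxmem] at hc
  rcases hc with hc | hc | ⟨hc₂, hc₁, r, rfl⟩
  · exact .inl hc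
  · exact .inr (.inl hc)
  · exact .inr (.inr ⟨r, fun h => hc₁ (by rw [h]), fun h => hc₂ (by rw [h]), rfl⟩)

lemma isPositroidFamily_of_noncrossing {n k : ℕ} {I : Finset (Fin n)} (hI : I.card = k)
    {X : Set (Fin n × Fin n)} (hX : ∀ p ∈ X, p.1 ∈ I ∧ p.2 ∉ I) (h : Noncrossing X) :
    IsPositroidFamily n k (transversalBases n k I X) := by
  classical
  set x := I.orderEmbOfFin hI with hxdef
  have hx : StrictMono x := x.strictMono
  have hxI : ∀ r, x r ∈ I := orderEmbOfFin_mem I hI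
  have hxmem : ∀ c, c ∈ I ↔ ∃ r, x r = c := fun c => by
    rw [← Set.mem_range, hxdef, range_orderEmbOfFin, mem_coe]
  let T : Fin k → Fin n → ℝ := fun r c => if c = x r ∨ (x r, c) ∈ X then 1 else 0
  have hT : IsUnitOn x T := by
    intro r s
    have : (x r, x s) ∉ X := fun h => (hX _ h).2 (hxI s)
    simp [T, this, hx.injective.eq_iff, eq_comm]
  have hT₀ : ∀ r c, 0 ≤ T r c := by
    intro r c; simp only [T]; split_ifs <;> norm_num
  have hTne : ∀ {r c}, T r c ≠ 0 → c = x r ∨ (x r, c) ∈ X := by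
    intro r c hne; by_contra hc; exact hne (if_neg hc)
  have hsign : ∀ g : Fin k → Fin n, g.Injective → ∏ r, T r (g r) ≠ 0 → arcSign x g = 1 := by
    intro g hg hne
    have hgx : ∀ r s, g r = x s → r = s := fun r s => hT.eq_of_prod_ne_zero hne
    refine prod_eq_one fun s _ => prod_eq_one fun r hr => ?_
    rw [mem_Ioi] at hr
    have hgT : ∀ r, g r = x r ∨ (x r, g r) ∈ X := fun r =>
      hTne (prod_ne_zero_iff.1 hne r (mem_univ r))
    rcases hgT s with hs | hs
    · exact arcPairSign_eq_one_of_fixed hx hg hgx hr (.inl hs)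
    rcases hgT r with hr' | hr'
    · exact arcPairSign_eq_one_of_fixed hx hg hgx hr (.inr hr')
    have hsr : x s ≠ g r := fun h => hr.ne' (hgx _ _ h.symm)
    have hrs : x r ≠ g s := fun h => hr.ne (hgx _ _ h.symm)
    exact arcPairSign_of_not_arcsCross (hx hr) (hg.ne hr.ne) hsr hrs
      (h.not_arcsCross hs hr' (hx hr).ne (hg.ne hr.ne) hsr hrs)
  have hterm : ∀ g : Fin k → Fin n, g.Injective →
      arcSign x g * ∏ r, T r (g r) = ∏ r, T r (g r) := by
    intro g hg
    by_cases hne : ∏ r, T r (g r) = 0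
    · rw [hne, mul_zero]
    · rw [hsign g hg hne, one_mul]
  have hinj : ∀ {B : Finset (Fin n)} (hB : B.card = k) (σ : Equiv.Perm (Fin k)),
      Function.Injective fun r => B.orderEmbOfFin hB (σ r) := fun hB σ =>
    (orderEmbOfFin _ hB).injective.comp σ.injective
  have hminor : ∀ {B : Finset (Fin n)} (hB : B.card = k), pMinor (signedMatrix x T) B =
      ∑ σ : Equiv.Perm (Fin k), ∏ r, T r (B.orderEmbOfFin hB (σ r)) := by
    intro B hB
    rw [pMinor_signedMatrix x T hB]
    exact sum_congr rfl fun σ _ => hterm _ (hinj hB σ)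
  have hprod : ∀ g : Fin k → Fin n, 0 ≤ ∏ r, T r (g r) := fun g =>
    prod_nonneg fun r _ => hT₀ r _
  refine ⟨signedMatrix x T, fun B hB => ?_, fun B => ⟨fun hBX => ⟨hBX.1, ?_⟩, ?_⟩⟩
  · rw [hminor hB]
    exact sum_nonneg fun σ _ => hprod _
  · obtain ⟨hB, f, hf, hfX⟩ := hBX
    have hfB : ∀ r, x r ∉ B → f (x r) ∈ B ∧ f (x r) ∉ I := fun r hr => by
      have := hf.mapsTo (mem_coe.2 (mem_sdiff.2 ⟨hxI r, hr⟩))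
      rwa [mem_coe, mem_sdiff] at this
    let g : Fin k → Fin n := fun r => if x r ∈ B then x r else f (x r)
    have hg : g.Injective := by
      intro r s hrs
      simp only [g] at hrs
      split_ifs at hrs with hr hs hs
      · exact hx.injective hrs
      · exact absurd (hrs ▸ hxI r) (hfB s hs).2
      · exact absurd (hrs ▸ hxI s) (hfB r hr).2
      · exact hx.injective (hf.injOn (mem_coe.2 (mem_sdiff.2 ⟨hxI r, hr⟩))
          (mem_coe.2 (mem_sdiff.2 ⟨hxI s, hs⟩)) hrs)
    have hgB : ∀ r, g r ∈ B := by
      intro r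
      simp only [g]
      split_ifs with hr
      · exact hr
      · exact (hfB r hr).1
    obtain ⟨σ, hσ⟩ := exists_perm_orderEmbOfFin_eq hB hg hgB
    rw [hminor hB]
    refine (sum_pos' (fun σ _ => hprod _) ⟨σ, mem_univ σ, prod_pos fun r _ => ?_⟩).ne'
    have : T r (g r) = 1 := by
      refine if_pos ?_
      by_cases hr : x r ∈ B
      · exact .inl (if_pos hr)
      · simp only [g, if_neg hr]
        exact .inr (hfX _ (mem_sdiff.2 ⟨hxI r, hr⟩))
    rw [hσ, this]; exact one_pos
  · rintro ⟨hB, hne⟩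
    rw [hminor hB] at hne
    obtain ⟨σ, -, hσ⟩ := exists_ne_zero_of_sum_ne_zero hne
    set g : Fin k → Fin n := fun r => B.orderEmbOfFin hB (σ r) with hgdef
    have hgx : ∀ r s, g r = x s → r = s := fun r s => hT.eq_of_prod_ne_zero hσ
    have hgB : ∀ r, g r ∈ B := fun r => orderEmbOfFin_mem B hB _
    have hBg : ∀ b ∈ B, ∃ r, g r = b := by
      intro b hb
      rw [← mem_coe, ← range_orderEmbOfFin B hB] at hb
      obtain ⟨r, rfl⟩ := hb
      exact ⟨σ.symm r, by simp [g]⟩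
    have hgI : ∀ r, x r ∉ B → (x r, g r) ∈ X := by
      intro r hr
      rcases hTne (prod_ne_zero_iff.1 hσ r (mem_univ r)) with h' | h'
      · exact absurd (h' ▸ hgB r) hr
      · exact h'
    have hext : ∀ r, Function.extend x g id (x r) = g r := fun r =>
      hx.injective.extend_apply _ _ r
    refine ⟨hB, Function.extend x g id, ⟨?_, ?_, ?_⟩, ?_⟩
    · intro i hi
      rw [mem_coe, mem_sdiff, hxmem] at hi
      obtain ⟨⟨r, rfl⟩, hr⟩ := hi
      rw [hext, mem_coe, mem_sdiff]
      exact ⟨hgB r, (hX _ (hgI r hr)).2⟩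
    · intro i hi j hj hij
      rw [mem_coe, mem_sdiff, hxmem] at hi hj
      obtain ⟨⟨r, rfl⟩, -⟩ := hi
      obtain ⟨⟨s, rfl⟩, -⟩ := hj
      rw [hext, hext] at hij
      rw [hinj hB σ hij]
    · intro b hb
      rw [mem_coe, mem_sdiff] at hb
      obtain ⟨r, rfl⟩ := hBg b hb.1
      refine ⟨x r, ?_, hext r⟩
      rw [mem_coe, mem_sdiff]
      refine ⟨hxI r, fun hr => hb.2 ?_⟩
      obtain ⟨s, hs⟩ := hBg _ hr
      rw [← hgx s r hs, hs]
      exact hxI r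
    · intro i hi
      rw [mem_sdiff, hxmem] at hi
      obtain ⟨⟨r, rfl⟩, hr⟩ := hi
      rw [hext]
      exact hgI r hr

/-- For `X ⊆ I × J` whose bipartite graph is a spanning tree of `[n]`, the principal
transversal matroid of `G(X)` is a positroid if and only if `X` is noncrossing. -/
theorem stmt_13 (k n : ℕ) (hk : 0 < k) (hkn : k < n) (I : Finset (Fin n)) (hI : I.card = k)
    (X : Set (Fin n × Fin n)) (hX : ∀ p ∈ X, p.1 ∈ I ∧ p.2 ∉ I)
    (htree : (SimpleGraph.fromRel (fun a b => (a, b) ∈ X)).IsTree) :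
    IsPositroidFamily n k (transversalBases n k I X) ↔ Noncrossing X :=
  ⟨noncrossing_of_isPositroidFamily hI hX htree.isAcyclic,
    isPositroidFamily_of_noncrossing hI hX⟩
end

section
/- Fix 0 < k < n and let x = (x_{rs}) be a k×n matrix whose entries are independent indeterminates, regarded as elements of the polynomial ring ℝ[x_{rs} : 1 ≤ r ≤ k, 1 ≤ s ≤ n]. For 1 ≤ i ≤ k and k+1 ≤ j ≤ n, let p_{K(i,j)} denote the determinant of the k×k submatrix of x on the columns indexed by K(i,j) in increasing order. Then the k(n−k) polynomials { p_{K(i,j)} : 1 ≤ i ≤ k, k+1 ≤ j ≤ n } are algebraically independent over ℝ. -/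
/-- The corectangle subset `K(i,j) = {1,…,i-1} ∪ {i+j-k,…,j}` of `[n]` (in one-indexed
terms; the elements of `Fin n` are taken zero-indexed). -/
def Kset (k n i j : ℕ) : Finset (Fin n) :=
  Finset.univ.filter fun x : Fin n =>
    x.val + 1 < i ∨ (i + j ≤ x.val + 1 + k ∧ x.val + 1 ≤ j)

theorem Matrix.det_mem_subring {R : Type*} [CommRing R] (C : Subring R) {m : ℕ}
    (A : Matrix (Fin m) (Fin m) R) (hA : ∀ a b, A a b ∈ C) : A.det ∈ C := by
  rw [Matrix.det_apply']
  exact C.sum_mem fun σ _ => C.mul_mem (intCast_mem C _) (C.prod_mem fun a _ => hA _ _)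

/-- If a subring contains the determinant of a matrix, the minor complementary to the top-left
entry, and all entries other than the top-left one, then it contains the product of
the top-left entry with that minor. -/
theorem Matrix.zero_zero_mul_det_mem_subring {R : Type*} [CommRing R] (C : Subring R) {m : ℕ}
    (A : Matrix (Fin (m + 1)) (Fin (m + 1)) R) (hdet : A.det ∈ C)
    (hrow : ∀ b : Fin m, A 0 b.succ ∈ C) (hA : ∀ (a : Fin m) b, A a.succ b ∈ C) :
    A 0 0 * (A.submatrix Fin.succ Fin.succ).det ∈ C := by
  rw [Matrix.det_succ_row_zero, Fin.sum_univ_succ] at hdet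
  have hrest := C.sum_mem (t := Finset.univ) fun (b : Fin m) _ =>
    C.mul_mem (C.mul_mem (C.pow_mem (C.neg_mem C.one_mem) (b.succ : ℕ)) (hrow b))
      (Matrix.det_mem_subring C (A.submatrix Fin.succ b.succ.succAbove) fun a c => hA a _)
  simpa using C.sub_mem hdet hrest

/-- The entries of a banded upper unitriangular matrix of width `l` whose entries strictly
above the diagonal, within the band, are independent indeterminates. -/
noncomputable def bandEntry (k l r s : ℕ) : MvPolynomial (Fin k × Fin l) ℝ :=
  if s = r then 1
  else if h : r < s ∧ r < k ∧ s - r - 1 < l then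
    MvPolynomial.X (⟨r, h.2.1⟩, ⟨s - r - 1, h.2.2⟩)
  else 0

theorem bandEntry_self (k l r : ℕ) : bandEntry k l r r = 1 := by simp [bandEntry]

theorem bandEntry_of_lt (k l : ℕ) {r s : ℕ} (h : s < r) : bandEntry k l r s = 0 := by
  rw [bandEntry, if_neg h.ne, dif_neg (by omega)]

theorem bandEntry_variable {k l : ℕ} (i : Fin k) (q : Fin l) :
    bandEntry k l i (i + q + 1) = MvPolynomial.X (i, q) := by
  have h : (i : ℕ) < i + q + 1 ∧ (i : ℕ) < k ∧ (i : ℕ) + q + 1 - i - 1 < l := by omega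
  rw [bandEntry, if_neg (by omega), dif_pos h]
  congr
  omega

/-- The minor of the banded matrix on `m` consecutive rows starting with `i` and
`m` consecutive columns starting with `i + q + 1`. -/
noncomputable def bandMinor (k l i q m : ℕ) : MvPolynomial (Fin k × Fin l) ℝ :=
  Matrix.det (Matrix.of fun a b : Fin m => bandEntry k l (i + a) (i + q + 1 + b))

theorem bandMinor_ne_zero {k l i q m : ℕ} (him : i + m ≤ k) (hq : q < l) :
    bandMinor k l i q m ≠ 0 := by
  intro h0
  let φ : MvPolynomial (Fin k × Fin l) ℝ →+* ℝ :=
    MvPolynomial.eval fun p => if (p.2 : ℕ) = q then 1 else 0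
  have h1 : φ (bandMinor k l i q m) = 1 := by
    rw [bandMinor, RingHom.map_det, Matrix.det_of_isLowerTriangular]
    · refine Finset.prod_eq_one fun a _ => ?_
      have h : i + a < i + q + 1 + a ∧ i + a < k ∧ i + q + 1 + a - (i + a) - 1 < l := by
        omega
      have h' : i + q + 1 + a - (i + a) - 1 = q := by omega
      have h'' : i + q + 1 + (a : ℕ) ≠ i + a := by omega
      simp only [RingHom.mapMatrix_apply, Matrix.map_apply, Matrix.of_apply]
      rw [bandEntry, if_neg h'', dif_pos h]
      simp [φ, h']
    · intro a b hab
      have hab' : (a : ℕ) < b := hab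
      simp only [RingHom.mapMatrix_apply, Matrix.map_apply, Matrix.of_apply]
      rw [bandEntry, if_neg (by omega)]
      split_ifs
      · simp only [φ, MvPolynomial.eval_X]
        exact if_neg (by omega)
      · exact map_zero _
  rw [h0, map_zero] at h1
  exact zero_ne_one h1

/-- A subring that contains the band minors reaching down to the last row, and that is
closed under division by nonzero elements, contains all entries of the banded matrix. -/
theorem bandEntry_mem_subring {k l : ℕ} (C : Subring (MvPolynomial (Fin k × Fin l) ℝ))
    (hdiv : ∀ x y, x ∈ C → x ≠ 0 → x * y ∈ C → y ∈ C)
    (hminor : ∀ i q, i < k → q < l → bandMinor k l i q (k - i) ∈ C) (r s : ℕ) :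
    bandEntry k l r s ∈ C := by
  by_cases hband : r < s ∧ r < k ∧ s - r - 1 < l
  swap
  · rw [bandEntry, dif_neg hband]
    split_ifs
    exacts [C.one_mem, C.zero_mem]
  obtain ⟨hrs, hrk, hq⟩ := hband
  obtain ⟨m, rfl⟩ : ∃ m, k = r + (m + 1) := ⟨k - r - 1, by omega⟩
  have hmin := hminor r (s - r - 1) hrk hq
  rw [show r + (m + 1) - r = m + 1 by omega] at hmin
  have hmul := Matrix.zero_zero_mul_det_mem_subring C _ hmin
    (fun b => bandEntry_mem_subring C hdiv hminor _ _)
    (fun a b => bandEntry_mem_subring C hdiv hminor _ _)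
  have hs : r + (s - r - 1) + 1 = s := by omega
  have hsub : ((Matrix.of fun a b : Fin (m + 1) =>
      bandEntry (r + (m + 1)) l (r + a) (r + (s - r - 1) + 1 + b)).submatrix
        Fin.succ Fin.succ).det = bandMinor (r + (m + 1)) l (r + 1) (s - r - 1) m := by
    rw [bandMinor]
    congr 1
    ext1 a b
    simp only [Matrix.submatrix_apply, Matrix.of_apply, Fin.val_succ]
    congr 1 <;> omega
  rw [hsub, mul_comm] at hmul
  have hmem : bandMinor (r + (m + 1)) l (r + 1) (s - r - 1) m ∈ C :=
    Matrix.det_mem_subring C _ fun a b => bandEntry_mem_subring C hdiv hminor _ _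
  simpa [hs] using hdiv _ _ hmem (bandMinor_ne_zero (by omega) hq) hmul
termination_by (k - r, k + l + r - s)
decreasing_by
  all_goals simp only [Prod.lex_def, Fin.val_succ, Fin.val_zero]; omega

theorem bandMinor_algebraicIndependent (k l : ℕ) :
    AlgebraicIndependent ℝ
      (fun p : Fin k × Fin l => bandMinor k l p.1 p.2 (k - p.1)) := by
  set f := fun p : Fin k × Fin l => bandMinor k l p.1 p.2 (k - p.1) with hf
  let B := Algebra.adjoin ℝ (Set.range f)
  let C := Subalgebra.algebraicClosure B (MvPolynomial (Fin k × Fin l) ℝ)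
  have hentry : ∀ r s, bandEntry k l r s ∈ C := by
    refine bandEntry_mem_subring C.toSubring (fun x y hx hx0 hxy => ?_) fun i q hi hq => ?_
    · exact IsAlgebraic.of_mul (mem_nonZeroDivisors_of_ne_zero hx0) hx hxy
    · exact C.algebraMap_mem
        ⟨_, Algebra.subset_adjoin (Set.mem_range_self (f := f) (⟨i, hi⟩, ⟨q, hq⟩))⟩
  have halg : Algebra.IsAlgebraic B (MvPolynomial (Fin k × Fin l) ℝ) := by
    refine ⟨fun x => ?_⟩
    change x ∈ C
    induction x using MvPolynomial.induction_on with
    | C a => exact C.algebraMap_mem (algebraMap ℝ B a)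
    | add x y hx hy => exact C.add_mem hx hy
    | mul_X x p hx =>
      refine C.mul_mem hx ?_
      rw [← bandEntry_variable p.1 p.2]
      exact hentry _ _
  refine (Algebra.IsAlgebraic.isTranscendenceBasis_of_le_trdeg_of_finite ℝ f ?_).1
  simp [MvPolynomial.trdeg_of_isDomain]

/-- Column `c` (zero-indexed) of the corectangle subset with an initial segment of length `i`
followed by a gap of length `q + 1`. -/
def gapColumn (i q c : ℕ) : ℕ := if c < i then c else c + q + 1

theorem gapColumn_strictMono (i q : ℕ) : StrictMono (gapColumn i q) := by
  intro a b hab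
  unfold gapColumn
  split_ifs <;> omega

theorem det_bandEntry_gapColumn (k l i q t m : ℕ) (hti : t ≤ i) (hi : i ≤ t + m) :
    Matrix.det (Matrix.of fun a b : Fin m => bandEntry k l (t + a) (gapColumn i q (t + b))) =
      bandMinor k l i q (t + m - i) := by
  induction m generalizing t with
  | zero =>
    obtain rfl : t = i := by omega
    rw [show t + 0 - t = 0 by omega]
    simp [bandMinor]
  | succ m ih =>
    obtain rfl | hlt := hti.eq_or_lt
    · rw [Nat.add_sub_cancel_left, bandMinor]
      congr 1
      ext1 a b
      simp only [Matrix.of_apply, gapColumn]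
      rw [if_neg (by omega)]
      congr 1
      omega
    · rw [Matrix.det_succ_column_zero, Fin.sum_univ_succ, Finset.sum_eq_zero, add_zero]
      · rw [show t + (m + 1) - i = t + 1 + m - i by omega, ← ih (t + 1) hlt (by omega)]
        simp only [Matrix.of_apply, gapColumn, Fin.val_zero, add_zero, if_pos hlt,
          bandEntry_self, pow_zero, one_mul]
        congr 1
        ext1 a b
        simp [Nat.add_assoc, Nat.add_comm 1]
      · intro a _
        simp [gapColumn, hlt, bandEntry_of_lt]

theorem pMinor_map {R S : Type*} [CommRing R] [CommRing S] {k n : ℕ} (φ : R →+* S)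
    (A : Matrix (Fin k) (Fin n) R) (I : Finset (Fin n)) :
    φ (pMinor A I) = pMinor (A.map φ) I := by
  unfold pMinor
  split_ifs
  · rw [RingHom.map_det]
    rfl
  · exact map_zero φ

theorem pMinor_eq_det_of_strictMono {R : Type*} [CommRing R] {k n : ℕ}
    (A : Matrix (Fin k) (Fin n) R) (f : Fin k → Fin n) (hf : StrictMono f)
    {I : Finset (Fin n)} (hI : Finset.univ.image f = I) :
    pMinor A I = Matrix.det (Matrix.of fun r c => A r (f c)) := by
  have hcard : I.card = k := by
    rw [← hI, Finset.card_image_of_injective _ hf.injective, Finset.card_univ, Fintype.card_fin]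
  have h := Finset.orderEmbOfFin_unique hcard
    (fun x => hI ▸ Finset.mem_image_of_mem f (Finset.mem_univ x)) hf
  rw [pMinor, dif_pos hcard, h]
  rfl

theorem pMinor_bandEntry_Kset {k n : ℕ} (hkn : k ≤ n) (i : Fin k) (q : Fin (n - k)) :
    pMinor (Matrix.of fun r s => bandEntry k (n - k) r s :
        Matrix (Fin k) (Fin n) (MvPolynomial (Fin k × Fin (n - k)) ℝ))
      (Kset k n (i + 1) (k + q + 1)) = bandMinor k (n - k) i q (k - i) := by
  have hlt : ∀ c : Fin k, gapColumn i q c < n := by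
    intro c
    unfold gapColumn
    split_ifs <;> omega
  rw [pMinor_eq_det_of_strictMono _ (fun c => ⟨gapColumn i q c, hlt c⟩)
    (fun a b hab => gapColumn_strictMono i q hab)]
  · have h := det_bandEntry_gapColumn k (n - k) i q 0 k (by omega) (by omega)
    simpa using h
  · ext x
    simp only [Finset.mem_image, Finset.mem_univ, true_and, Kset, Finset.mem_filter,
      Fin.ext_iff, gapColumn]
    constructor
    · rintro ⟨c, hc⟩
      split_ifs at hc <;> omega
    · intro hx
      by_cases hxi : (x : ℕ) < i
      · exact ⟨⟨x, by omega⟩, if_pos hxi⟩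
      · refine ⟨⟨x - q - 1, by omega⟩, ?_⟩
        rw [if_neg (by simp only; omega)]
        simp only
        omega

/-- The `k(n-k)` corectangle maximal minors `p_{K(i,j)}`, `1 ≤ i ≤ k`,
`k+1 ≤ j ≤ n`, of a `k × n` matrix of independent indeterminates are algebraically
independent over `ℝ`. -/
theorem stmt_15 (k n : ℕ) (hk : 0 < k) (hkn : k < n) :
    AlgebraicIndependent ℝ
      (fun p : Fin k × Fin (n - k) =>
        pMinor (fun r s => MvPolynomial.X (r, s) :
            Matrix (Fin k) (Fin n) (MvPolynomial (Fin k × Fin n) ℝ))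
          (Kset k n (p.1.val + 1) (k + p.2.val + 1))) := by
  let φ : MvPolynomial (Fin k × Fin n) ℝ →ₐ[ℝ] MvPolynomial (Fin k × Fin (n - k)) ℝ :=
    MvPolynomial.aeval fun p => bandEntry k (n - k) p.1 p.2
  refine AlgebraicIndependent.of_comp φ ?_
  convert bandMinor_algebraicIndependent k (n - k) using 1
  funext p
  rw [← pMinor_bandEntry_Kset hkn.le]
  refine (pMinor_map φ.toRingHom _ _).trans ?_
  congr 1
  ext1 r s
  exact MvPolynomial.aeval_X _ _
end
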